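/- The function Φ is even: for every x ∈ ℝ, Φ(−x) = Φ(x). -/

import Mathlib

open Real

/-- The Fourier kernel of the Riemann Xi function:
`Φ(x) = Σ_{n=1}^∞ (4π²n⁴e^{9x/2} − 6πn²e^{5x/2}) exp(−πn²e^{2x})`. -/
noncomputable def RiemannPhi (x : ℝ) : ℝ :=
  ∑' n : ℕ, (4 * π ^ 2 * ((n : ℝ) + 1) ^ 4 * Real.exp (9 * x / 2)
      - 6 * π * ((n : ℝ) + 1) ^ 2 * Real.exp (5 * x / 2))
    * Real.exp (-π * ((n : ℝ) + 1) ^ 2 * Real.exp (2 * x))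

/-- Moments of the theta series. -/
noncomputable def thetaT (k : ℕ) (t : ℝ) : ℝ :=
  ∑' n : ℕ, ((n : ℝ) + 1) ^ (2 * k) * Real.exp (-π * ((n : ℝ) + 1) ^ 2 * t)

lemma thetaT_summable (k : ℕ) {t : ℝ} (ht : 0 < t) :
    Summable fun n : ℕ => ((n : ℝ) + 1) ^ (2 * k) * Real.exp (-π * ((n : ℝ) + 1) ^ 2 * t) := by
  have h := (summable_nat_add_iff 1).2
    (Real.summable_pow_mul_exp_neg_nat_mul (2 * k) (r := π * t) (by positivity))
  refine Summable.of_nonneg_of_le (fun n => by positivity) (fun n => ?_) h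
  push_cast
  refine mul_le_mul_of_nonneg_left (Real.exp_le_exp.2 ?_) (by positivity)
  have hn : (0 : ℝ) ≤ n := n.cast_nonneg
  have : 0 ≤ π * t * ((n : ℝ) * (n + 1)) := by positivity
  nlinarith

lemma thetaT_hasDerivAt (k : ℕ) {t : ℝ} (ht : 0 < t) :
    HasDerivAt (thetaT k) (-π * thetaT (k + 1) t) t := by
  have key := hasDerivAt_tsum_of_isPreconnected (𝕜 := ℝ) (F := ℝ)
    (u := fun n : ℕ => π * (((n : ℝ) + 1) ^ (2 * (k + 1)) *
      Real.exp (-π * ((n : ℝ) + 1) ^ 2 * (t / 2))))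
    (g := fun (n : ℕ) (t : ℝ) => ((n : ℝ) + 1) ^ (2 * k) * Real.exp (-π * ((n : ℝ) + 1) ^ 2 * t))
    (g' := fun (n : ℕ) (t : ℝ) => -π * (((n : ℝ) + 1) ^ (2 * (k + 1)) *
      Real.exp (-π * ((n : ℝ) + 1) ^ 2 * t)))
    (t := Set.Ioi (t / 2)) (y₀ := t) (y := t)
    ((thetaT_summable (k + 1) (half_pos ht)).mul_left π) isOpen_Ioi isPreconnected_Ioi
    (fun n y _ => ?_) (fun n y hy => ?_) (by simpa using ht) (thetaT_summable k ht)
    (by simpa using ht)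
  · rw [tsum_mul_left] at key
    exact key
  · have h := (((hasDerivAt_id y).const_mul (-π * ((n : ℝ) + 1) ^ 2)).exp).const_mul
      (((n : ℝ) + 1) ^ (2 * k))
    refine h.congr_deriv ?_
    simp only [id]
    ring
  · have hy' : t / 2 < y := hy
    rw [norm_mul, norm_neg, Real.norm_of_nonneg pi_pos.le, Real.norm_of_nonneg (by positivity)]
    gcongr _ * (_ * Real.exp ?_)
    have : 0 ≤ π * ((n : ℝ) + 1) ^ 2 := by positivity
    nlinarith

lemma theta_int {t : ℝ} (ht : 0 < t) :
    ∑' n : ℤ, Real.exp (-π * t * (n : ℝ) ^ 2) = 1 + 2 * thetaT 0 t := by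
  have hs : HasSum (fun n : ℕ => Real.exp (-π * t * (((n : ℤ) + 1 : ℤ) : ℝ) ^ 2)) (thetaT 0 t) := by
    convert! (thetaT_summable 0 ht).hasSum using 2 with n
    push_cast
    simp only [pow_zero, one_mul]
    ring_nf
  have hs' : HasSum (fun n : ℕ => Real.exp (-π * t * ((-((n : ℤ) + 1) : ℤ) : ℝ) ^ 2))
      (thetaT 0 t) := by
    convert! hs using 3 with n
    push_cast
    ring
  have := HasSum.of_add_one_of_neg_add_one (f := fun n : ℤ => Real.exp (-π * t * (n : ℝ) ^ 2)) hs hs'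
  rw [this.tsum_eq]
  simp
  ring

/-- `e^{x/2} θ(e^{2x})`. -/
noncomputable def gTheta (x : ℝ) : ℝ := Real.exp (x / 2) * (1 + 2 * thetaT 0 (Real.exp (2 * x)))

lemma gTheta_even (x : ℝ) : gTheta (-x) = gTheta x := by
  have h := Real.tsum_exp_neg_mul_int_sq (a := Real.exp (2 * x)) (Real.exp_pos _)
  have e : ∀ n : ℤ, -π / Real.exp (2 * x) * (n : ℝ) ^ 2 = -π * Real.exp (2 * -x) * (n : ℝ) ^ 2 := by
    intro n
    rw [mul_neg, Real.exp_neg, div_eq_mul_inv]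
  simp_rw [e] at h
  rw [theta_int (Real.exp_pos _), theta_int (Real.exp_pos _), ← Real.exp_mul] at h
  unfold gTheta
  rw [h, ← mul_assoc, one_div, ← Real.exp_neg, ← Real.exp_add]
  congr 2
  ring

lemma thetaT_exp_hasDerivAt (k : ℕ) (x : ℝ) :
    HasDerivAt (fun x => thetaT k (Real.exp (2 * x)))
      (-π * thetaT (k + 1) (Real.exp (2 * x)) * (Real.exp (2 * x) * 2)) x := by
  have h1 : HasDerivAt (fun x : ℝ => Real.exp (2 * x)) (Real.exp (2 * x) * 2) x := by
    simpa using ((hasDerivAt_id x).const_mul 2).exp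
  exact (thetaT_hasDerivAt k (Real.exp_pos (2 * x))).comp x h1

lemma exp_lin_hasDerivAt (c x : ℝ) :
    HasDerivAt (fun x : ℝ => Real.exp (c * x / 2)) (Real.exp (c * x / 2) * (c / 2)) x := by
  simpa using (((hasDerivAt_id x).const_mul c).div_const 2).exp

lemma gTheta_deriv (x : ℝ) : HasDerivAt gTheta
    (gTheta x / 2 - 4 * π * (Real.exp (5 * x / 2) * thetaT 1 (Real.exp (2 * x)))) x := by
  have h := (exp_lin_hasDerivAt 1 x).mul (((thetaT_exp_hasDerivAt 0 x).const_mul 2).const_add 1)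
  simp only [one_mul] at h
  refine h.congr_deriv ?_
  have e : Real.exp (5 * x / 2) = Real.exp (x / 2) * Real.exp (2 * x) := by
    rw [← Real.exp_add]; congr 1; ring
  rw [e]
  unfold gTheta
  ring

lemma phi_eq (x : ℝ) : RiemannPhi x = 4 * π ^ 2 * (Real.exp (9 * x / 2) * thetaT 2 (Real.exp (2 * x)))
    - 6 * π * (Real.exp (5 * x / 2) * thetaT 1 (Real.exp (2 * x))) := by
  have h2 := ((thetaT_summable 2 (Real.exp_pos (2 * x))).hasSum.mul_left
    (Real.exp (9 * x / 2))).mul_left (4 * π ^ 2)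
  have h1 := ((thetaT_summable 1 (Real.exp_pos (2 * x))).hasSum.mul_left
    (Real.exp (5 * x / 2))).mul_left (6 * π)
  refine Eq.trans ?_ (h2.sub h1).tsum_eq
  unfold RiemannPhi
  congr 1
  funext n
  ring

lemma gTheta_deriv2 (x : ℝ) : HasDerivAt (deriv gTheta) (gTheta x / 4 + 2 * RiemannPhi x) x := by
  rw [funext fun y => (gTheta_deriv y).deriv]
  have h := ((gTheta_deriv x).div_const 2).sub
    (((exp_lin_hasDerivAt 5 x).mul (thetaT_exp_hasDerivAt 1 x)).const_mul (4 * π))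
  refine h.congr_deriv ?_
  rw [phi_eq]
  have e : Real.exp (9 * x / 2) = Real.exp (5 * x / 2) * Real.exp (2 * x) := by
    rw [← Real.exp_add]; congr 1; ring
  rw [e]
  ring

theorem phi_even (x : ℝ) : RiemannPhi (-x) = RiemannPhi x := by
  have hodd : ∀ y, deriv gTheta (-y) = -deriv gTheta y := by
    intro y
    have h := deriv_comp_neg gTheta y
    rw [funext gTheta_even] at h
    change deriv gTheta y = _ at h
    linarith
  have h := deriv_comp_neg (deriv gTheta) x
  rw [funext hodd, deriv.fun_neg, (gTheta_deriv2 x).deriv, (gTheta_deriv2 (-x)).deriv,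
    gTheta_even] at h
  linarith
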